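/- arXiv:2304.02599 — 2 statements merged into one kernel-verified Lean document; each statement's English description precedes it below -/
import Mathlib

section
/- Let d ≥ 1, κ ≥ 1, and let V : ℝ^d → ℝ be continuously differentiable, 1-strongly convex, and κ-smooth, with V(0) = 0 and ∇V(0) = 0. Define B_V(1) := {x ∈ ℝ^d : V(x) ≤ 1}, and for t ≥ 1 let t·B_V(1) denote the dilation of B_V(1) about the origin by the factor t. Then for every integer t ≥ 1, the probability that a sample from the probability distribution π on ℝ^d with density proportional to exp(−V) lies outside t·B_V(1) satisfies π(ℝ^d ∖ t·B_V(1)) ≤ ∑_{u=t}^{∞} e^{−(u−1)} (u+1)^d. -/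
open MeasureTheory
open scoped NNReal Pointwise

lemma aux_lower {d : ℕ} (V : EuclideanSpace ℝ (Fin d) → ℝ)
    (hV1 : ContDiff ℝ 1 V)
    (hconv : ConvexOn ℝ Set.univ (fun x => V x - ‖x‖ ^ 2 / 2))
    (h0 : V 0 = 0) (hg0 : gradient V 0 = 0) (x : EuclideanSpace ℝ (Fin d)) :
    ‖x‖ ^ 2 / 2 ≤ V x := by
  have hdV : HasFDerivAt V (0 : EuclideanSpace ℝ (Fin d) →L[ℝ] ℝ) 0 := by
    have h := (hV1.differentiable (by norm_num) 0).hasGradientAt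
    rw [hg0] at h
    have := h.hasFDerivAt
    simpa using this
  have hg : HasDerivAt (fun s : ℝ => V (s • x)) 0 0 := by
    have h1 : HasDerivAt (fun s : ℝ => s • x) x 0 := by
      simpa using (hasDerivAt_id (0 : ℝ)).smul_const x
    have h2 : HasFDerivAt V (0 : EuclideanSpace ℝ (Fin d) →L[ℝ] ℝ) ((fun s : ℝ => s • x) 0) := by
      simpa using hdV
    have h3 := h2.comp_hasDerivAt (0 : ℝ) h1
    simp only [ContinuousLinearMap.zero_apply] at h3
    exact h3
  have hg' : HasDerivAt (fun s : ℝ => V (s • x) - s ^ 2 * (‖x‖ ^ 2 / 2)) 0 0 := by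
    have := hg.sub (((hasDerivAt_id (0 : ℝ)).pow 2).mul_const (‖x‖ ^ 2 / 2))
    refine HasDerivAt.congr_deriv (f' := _) this ?_
    simp
  have hc : ConvexOn ℝ Set.univ (fun s : ℝ => V (s • x) - s ^ 2 * (‖x‖ ^ 2 / 2)) := by
    have := hconv.comp_linearMap (LinearMap.toSpanSingleton ℝ _ x)
    refine this.congr ?_ |>.subset (by simp) convex_univ
    intro s _
    simp [norm_smul, mul_pow]
    ring
  have := hc.le_slope_of_hasDerivAt (Set.mem_univ 0) (Set.mem_univ 1) one_pos hg'
  simp [slope_def_field, h0] at this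
  linarith

lemma aux_scale {d : ℕ} (V : EuclideanSpace ℝ (Fin d) → ℝ)
    (hc : ConvexOn ℝ Set.univ V) (h0 : V 0 = 0) (u : ℕ) (hu : 1 ≤ u)
    (x : EuclideanSpace ℝ (Fin d)) (hx : x ∉ (u : ℝ) • {x | V x ≤ 1}) : (u : ℝ) ≤ V x := by
  have hu' : (1 : ℝ) ≤ u := by exact_mod_cast hu
  have hu0 : (0 : ℝ) < u := by linarith
  rw [Set.mem_smul_set_iff_inv_smul_mem₀ hu0.ne'] at hx
  simp only [Set.mem_ofPred_eq, not_le] at hx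
  have h := hc.2 (Set.mem_univ x) (Set.mem_univ 0) (inv_nonneg.2 hu0.le)
    (sub_nonneg.2 (inv_le_one_of_one_le₀ hu')) (by ring)
  simp only [smul_zero, add_zero, h0, smul_eq_mul, mul_zero] at h
  have h3 : 1 < (u : ℝ)⁻¹ * V x := lt_of_lt_of_le hx h
  rw [inv_mul_eq_div, lt_div_iff₀ hu0] at h3
  linarith

lemma aux_summable (d t : ℕ) : Summable (fun u : ℕ =>
    if t ≤ u then Real.exp (-((u : ℝ) - 1)) * ((u : ℝ) + 1) ^ d else 0) := by
  have h := (summable_nat_add_iff 1).2 (Real.summable_pow_mul_exp_neg_nat_mul d one_pos)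
  have h2 := h.mul_left (Real.exp 2)
  refine Summable.of_nonneg_of_le (fun u => ?_) (fun u => ?_) h2
  · split_ifs <;> positivity
  · split_ifs
    · have : Real.exp (-((u : ℝ) - 1)) = Real.exp 2 * Real.exp (-1 * ((u + 1 : ℕ) : ℝ)) := by
        rw [← Real.exp_add]; congr 1; push_cast; ring
      rw [this]; push_cast; apply le_of_eq; ring
    · positivity

/-- For `π ∝ exp(−V)` with `V` `1`-strongly convex, `κ`-smooth, minimized
at the origin with `V(0) = 0`, and every integer `t ≥ 1`,
`π(ℝ^d ∖ t·B_V(1)) ≤ ∑_{u=t}^∞ e^{−(u−1)} (u+1)^d`. -/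
theorem stmt_16 (d : ℕ) (hd : 1 ≤ d) (κ : ℝ≥0) (hκ : 1 ≤ κ)
    (V : EuclideanSpace ℝ (Fin d) → ℝ)
    (hV1 : ContDiff ℝ 1 V)
    (hconv : ConvexOn ℝ Set.univ (fun x => V x - ‖x‖ ^ 2 / 2))
    (hsmooth : LipschitzWith κ (gradient V))
    (h0 : V 0 = 0) (hg0 : gradient V 0 = 0)
    (t : ℕ) (ht : 1 ≤ t) :
    ((ENNReal.ofReal (∫ x, Real.exp (-V x)))⁻¹ •
        (volume.withDensity fun x => ENNReal.ofReal (Real.exp (-V x))))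
      (((t : ℝ) • {x | V x ≤ 1})ᶜ) ≤
      ENNReal.ofReal
        (∑' u : ℕ, if t ≤ u then Real.exp (-((u : ℝ) - 1)) * ((u : ℝ) + 1) ^ d else 0) := by
  have hlow := aux_lower V hV1 hconv h0 hg0
  have hVc : Continuous V := hV1.continuous
  have hc : ConvexOn ℝ Set.univ V := by
    have h1 : ConvexOn ℝ Set.univ (fun x : EuclideanSpace ℝ (Fin d) => ‖x‖ ^ 2 / 2) := by
      have := (convexOn_univ_norm (E := EuclideanSpace ℝ (Fin d))).pow
        (fun _ _ => norm_nonneg _) 2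
      have := this.smul (c := (1 / 2 : ℝ)) (by norm_num)
      refine this.congr ?_
      intro x _
      simp
      ring
    refine (hconv.add h1).congr ?_
    intro x _
    simp
  have hcont : Continuous (fun x => Real.exp (-V x)) := by fun_prop
  have hint : Integrable (fun x => Real.exp (-V x)) := by
    have hG := (GaussianFourier.integrable_cexp_neg_mul_sq_norm_add
      (V := EuclideanSpace ℝ (Fin d)) (b := 1 / 2) (by norm_num) 0 0).norm
    refine hG.mono' hcont.aestronglyMeasurable (Filter.Eventually.of_forall fun x => ?_)
    rw [Complex.norm_exp, Real.norm_of_nonneg (Real.exp_pos _).le]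
    apply Real.exp_le_exp.2
    have e : (-(1 / 2 : ℂ) * (‖x‖ : ℂ) ^ 2
        + 0 * ((inner ℝ (0 : EuclideanSpace ℝ (Fin d)) x : ℝ) : ℂ)) =
        ((-(‖x‖ ^ 2 / 2) : ℝ) : ℂ) := by
      push_cast; ring
    rw [e, Complex.ofReal_re]
    linarith [hlow x]
  rw [ofReal_integral_eq_lintegral_ofReal hint
    (Filter.Eventually.of_forall fun x => (Real.exp_pos _).le)]
  set Z := ∫⁻ x, ENNReal.ofReal (Real.exp (-V x)) with hZ
  set B : Set (EuclideanSpace ℝ (Fin d)) := {x | V x ≤ 1} with hB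
  have hBclosed : IsClosed B := isClosed_le hVc continuous_const
  set μ := (volume : Measure (EuclideanSpace ℝ (Fin d))).withDensity
    (fun x => ENNReal.ofReal (Real.exp (-V x))) with hμ
  have hvB : volume B ≤ ENNReal.ofReal (Real.exp 1) * Z := by
    have h1 : ENNReal.ofReal (Real.exp (-1)) * volume B ≤ Z := by
      rw [← setLIntegral_const]
      refine (setLIntegral_mono' hBclosed.measurableSet fun x hx => ?_).trans
        (setLIntegral_le_lintegral B _)
      apply ENNReal.ofReal_le_ofReal
      apply Real.exp_le_exp.2
      have : V x ≤ 1 := hx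
      linarith
    calc volume B = ENNReal.ofReal (Real.exp 1) * (ENNReal.ofReal (Real.exp (-1)) * volume B) := by
          rw [← mul_assoc, ← ENNReal.ofReal_mul (Real.exp_pos _).le, ← Real.exp_add]; simp
      _ ≤ _ := by gcongr
  have hmeas : ∀ u : ℕ, 1 ≤ u → MeasurableSet ((u : ℝ) • B) := fun u hu =>
    hBclosed.measurableSet.const_smul₀ (u : ℝ)
  have hshell : ∀ u : ℕ, t ≤ u → μ ((((u + 1 : ℕ) : ℝ) • B) \ ((u : ℝ) • B)) ≤
      ENNReal.ofReal (Real.exp (-((u : ℝ) - 1)) * ((u : ℝ) + 1) ^ d) * Z := by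
    intro u hu
    have hu1 : 1 ≤ u := ht.trans hu
    have hm := (hmeas (u + 1) (by omega)).diff (hmeas u hu1)
    rw [hμ, withDensity_apply _ hm]
    calc ∫⁻ x in (((u + 1 : ℕ) : ℝ) • B) \ ((u : ℝ) • B), ENNReal.ofReal (Real.exp (-V x))
        ≤ ∫⁻ x in (((u + 1 : ℕ) : ℝ) • B) \ ((u : ℝ) • B), ENNReal.ofReal (Real.exp (-u)) := by
          refine setLIntegral_mono' hm fun x hx => ?_
          apply ENNReal.ofReal_le_ofReal
          apply Real.exp_le_exp.2
          have := aux_scale V hc h0 u hu1 x hx.2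
          linarith
      _ ≤ ENNReal.ofReal (Real.exp (-u)) * volume (((u + 1 : ℕ) : ℝ) • B) := by
          rw [setLIntegral_const]
          gcongr
          exact Set.sdiff_subset
      _ = ENNReal.ofReal (Real.exp (-u)) * (ENNReal.ofReal (((u : ℝ) + 1) ^ d) * volume B) := by
          rw [Measure.addHaar_smul]
          simp only [finrank_euclideanSpace, Fintype.card_fin]
          rw [abs_of_nonneg (by positivity)]
          push_cast
          rfl
      _ ≤ ENNReal.ofReal (Real.exp (-u)) * (ENNReal.ofReal (((u : ℝ) + 1) ^ d) *
            (ENNReal.ofReal (Real.exp 1) * Z)) := by gcongr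
      _ = _ := by
          rw [← mul_assoc, ← mul_assoc, ← ENNReal.ofReal_mul (Real.exp_pos _).le,
            ← ENNReal.ofReal_mul (by positivity)]
          congr 2
          have : Real.exp (-((u : ℝ) - 1)) = Real.exp (-u) * Real.exp 1 := by
            rw [← Real.exp_add]; congr 1; ring
          rw [this]; ring
  have hcover : ((t : ℝ) • B)ᶜ ⊆ ⋃ u : ℕ, ⋃ _ : t ≤ u,
      (((u + 1 : ℕ) : ℝ) • B) \ ((u : ℝ) • B) := by
    intro x hx
    by_contra hcon
    simp only [Set.mem_iUnion, not_exists] at hcon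
    have hall : ∀ u : ℕ, t ≤ u → x ∉ (u : ℝ) • B := by
      intro u hu
      induction u, hu using Nat.le_induction with
      | base => exact hx
      | succ n hn ih => exact fun hmem => hcon n hn ⟨hmem, ih⟩
    obtain ⟨n, hn⟩ := exists_nat_gt (V x)
    have h1 := aux_scale V hc h0 (max n t) (ht.trans (le_max_right _ _)) x
      (hall _ (le_max_right _ _))
    have h2 : (n : ℝ) ≤ ((max n t : ℕ) : ℝ) := by exact_mod_cast le_max_left n t
    linarith
  have hnn : ∀ u : ℕ, 0 ≤ (if t ≤ u then Real.exp (-((u : ℝ) - 1)) * ((u : ℝ) + 1) ^ d else 0) := by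
    intro u
    split_ifs <;> positivity
  rw [ENNReal.ofReal_tsum_of_nonneg hnn (aux_summable d t)]
  rw [Measure.smul_apply, smul_eq_mul]
  calc Z⁻¹ * μ (((t : ℝ) • B)ᶜ)
      ≤ Z⁻¹ * ((∑' u : ℕ, ENNReal.ofReal
        (if t ≤ u then Real.exp (-((u : ℝ) - 1)) * ((u : ℝ) + 1) ^ d else 0)) * Z) := by
        gcongr
        refine (measure_mono hcover).trans ((measure_iUnion_le _).trans ?_)
        rw [← ENNReal.tsum_mul_right]
        refine ENNReal.tsum_le_tsum fun u => ?_
        by_cases hu : t ≤ u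
        · simpa [hu] using hshell u hu
        · simp [hu]
    _ = (Z⁻¹ * Z) * (∑' u : ℕ, ENNReal.ofReal
        (if t ≤ u then Real.exp (-((u : ℝ) - 1)) * ((u : ℝ) + 1) ^ d else 0)) := by ring
    _ ≤ 1 * _ := by
        gcongr
        exact ENNReal.inv_mul_le_one Z
    _ = _ := one_mul _
end

section
/- There exists a universal constant C > 0 such that for every real κ ≥ 2 and every real 0 < δ < 1/2, there exists a real polynomial q of degree at most C · √κ · log(κ/δ) such that |q(x) − x^{−1/2}| ≤ δ/√κ for all real x with 1 ≤ x ≤ κ. -/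
open Finset in
/-- Normalized central binomial coefficients. -/
noncomputable def cA (n : ℕ) : ℝ := (n.centralBinom : ℝ) / 4 ^ n

theorem cA_succ (n : ℕ) : ((n : ℝ) + 1) * cA (n + 1) = ((n : ℝ) + 1 / 2) * cA n := by
  have h := Nat.succ_mul_centralBinom_succ n
  have h' : ((n : ℝ) + 1) * ((n + 1).centralBinom : ℝ) = 2 * (2 * n + 1) * (n.centralBinom : ℝ) := by
    exact_mod_cast h
  unfold cA
  rw [pow_succ, ← mul_div_assoc, h']
  field_simp
  ring

theorem cA_nonneg (n : ℕ) : 0 ≤ cA n := by unfold cA; positivity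

theorem cA_le_one (n : ℕ) : cA n ≤ 1 := by
  unfold cA
  rw [div_le_one (by positivity)]
  exact_mod_cast Nat.centralBinom_le_four_pow n

open Finset in
theorem cA_weighted (n : ℕ) :
    2 * ∑ kl ∈ antidiagonal n, (kl.1 : ℝ) * (cA kl.1 * cA kl.2) =
      n * ∑ kl ∈ antidiagonal n, cA kl.1 * cA kl.2 := by
  have h : ∑ kl ∈ antidiagonal n, (kl.1 : ℝ) * (cA kl.1 * cA kl.2) =
      ∑ kl ∈ antidiagonal n, (kl.2 : ℝ) * (cA kl.1 * cA kl.2) := by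
    rw [← Finset.Nat.sum_antidiagonal_swap]
    refine sum_congr rfl fun p _ => ?_
    simp only [Prod.fst_swap, Prod.snd_swap]
    ring
  rw [two_mul]
  nth_rewrite 2 [h]
  rw [← sum_add_distrib, mul_sum]
  refine sum_congr rfl fun p hp => ?_
  rw [Finset.HasAntidiagonal.mem_antidiagonal] at hp
  rw [← hp]
  push_cast
  ring

open Finset in
theorem cA_conv (n : ℕ) : ∑ kl ∈ antidiagonal n, cA kl.1 * cA kl.2 = 1 := by
  induction n with
  | zero => simp [cA]
  | succ n ih =>
    have h1 := cA_weighted (n + 1)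
    have h0 := cA_weighted n
    rw [Finset.Nat.sum_antidiagonal_succ] at h1
    have h2 : ∑ p ∈ antidiagonal n, ((p.1 + 1 : ℕ) : ℝ) * (cA (p.1 + 1) * cA p.2) =
        ∑ p ∈ antidiagonal n, (p.1 : ℝ) * (cA p.1 * cA p.2) +
          1 / 2 * ∑ p ∈ antidiagonal n, cA p.1 * cA p.2 := by
      rw [mul_sum, ← sum_add_distrib]
      refine sum_congr rfl fun p _ => ?_
      push_cast
      rw [← mul_assoc, cA_succ]
      ring
    simp only [] at h1
    rw [h2] at h1
    rw [ih] at h1 h0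
    push_cast at h1
    have h3 : ((n : ℝ) + 1) * ∑ kl ∈ antidiagonal (n + 1), cA kl.1 * cA kl.2 = (n + 1) * 1 := by
      rw [← h1]; linarith
    exact mul_left_cancel₀ (by positivity) h3

open Finset in
/-- Legendre polynomials, in their Chebyshev expansion. -/
noncomputable def lP (n : ℕ) : Polynomial ℝ :=
  ∑ kl ∈ antidiagonal n, Polynomial.C (cA kl.1 * cA kl.2) *
    Polynomial.Chebyshev.T ℝ ((kl.1 : ℤ) - kl.2)

open Finset in
theorem lP_natDegree (n : ℕ) : (lP n).natDegree ≤ n := by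
  unfold lP
  refine Polynomial.natDegree_sum_le_of_forall_le _ _ fun p hp => ?_
  refine (Polynomial.natDegree_C_mul_le _ _).trans ?_
  rw [Polynomial.Chebyshev.natDegree_T]
  rw [Finset.HasAntidiagonal.mem_antidiagonal] at hp
  omega

open Finset in
theorem lP_eval (n : ℕ) (θ : ℝ) : (lP n).eval (Real.cos θ) =
    ∑ kl ∈ antidiagonal n, cA kl.1 * cA kl.2 * Real.cos (((kl.1 : ℝ) - kl.2) * θ) := by
  unfold lP
  rw [Polynomial.eval_finsetSum]
  refine sum_congr rfl fun p hp => ?_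
  rw [Polynomial.eval_mul, Polynomial.eval_C, Polynomial.Chebyshev.T_real_cos]
  push_cast
  rfl

open Finset in
theorem lP_abs (n : ℕ) (θ : ℝ) : |(lP n).eval (Real.cos θ)| ≤ 1 := by
  rw [lP_eval, ← cA_conv n]
  refine (abs_sum_le_sum_abs _ _).trans (sum_le_sum fun p _ => ?_)
  have h : 0 ≤ cA p.1 * cA p.2 := mul_nonneg (cA_nonneg _) (cA_nonneg _)
  rw [abs_mul, abs_of_nonneg h]
  exact mul_le_of_le_one_right h (Real.abs_cos_le_one _)

theorem cA_summable (z : ℂ) (hz : ‖z‖ < 1) : Summable fun n => ‖(cA n : ℂ) * z ^ n‖ := by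
  refine Summable.of_nonneg_of_le (fun _ => norm_nonneg _) (fun n => ?_)
    (summable_geometric_of_lt_one (norm_nonneg z) hz)
  rw [norm_mul, norm_pow, Complex.norm_real, Real.norm_of_nonneg (cA_nonneg n)]
  exact mul_le_of_le_one_left (by positivity) (cA_le_one n)

open Finset in
theorem cA_sq (z : ℂ) (hz : ‖z‖ < 1) :
    (∑' n, (cA n : ℂ) * z ^ n) * (∑' n, (cA n : ℂ) * z ^ n) = (1 - z)⁻¹ := by
  rw [tsum_mul_tsum_eq_tsum_sum_antidiagonal_of_summable_norm (cA_summable z hz) (cA_summable z hz),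
    ← tsum_geometric_of_norm_lt_one hz]
  refine tsum_congr fun n => ?_
  have h : ∑ kl ∈ antidiagonal n, (cA kl.1 : ℂ) * z ^ kl.1 * ((cA kl.2 : ℂ) * z ^ kl.2) =
      ((∑ kl ∈ antidiagonal n, cA kl.1 * cA kl.2 : ℝ) : ℂ) * z ^ n := by
    push_cast
    rw [sum_mul]
    refine sum_congr rfl fun p hp => ?_
    rw [Finset.HasAntidiagonal.mem_antidiagonal] at hp
    rw [← hp, pow_add]
    ring
  rw [h, cA_conv]
  simp

open Finset ComplexConjugate in
theorem lP_hasSum (r θ : ℝ) (h0 : 0 ≤ r) (h1 : r < 1) :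
    HasSum (fun n => r ^ n * (lP n).eval (Real.cos θ))
      (1 / Real.sqrt (1 + r ^ 2 - 2 * r * Real.cos θ)) := by
  set z : ℂ := r * Complex.exp (θ * Complex.I) with hzdef
  have hzn : ‖z‖ = r := by
    rw [hzdef, norm_mul, Complex.norm_exp_ofReal_mul_I, Complex.norm_real,
      Real.norm_of_nonneg h0, mul_one]
  have hz : ‖z‖ < 1 := by rw [hzn]; exact h1
  have hz' : ‖conj z‖ < 1 := by rw [Complex.norm_conj]; exact hz
  have hzc : conj z = r * Complex.exp (-(θ * Complex.I)) := by
    rw [hzdef, map_mul, Complex.conj_ofReal, ← Complex.exp_conj]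
    simp
  set F : ℂ := ∑' n, (cA n : ℂ) * z ^ n with hF
  have hFc : ∑' n, (cA n : ℂ) * (conj z) ^ n = conj F := by
    rw [hF, Complex.conj_tsum]
    refine tsum_congr fun n => ?_
    simp
  have hprod := tsum_mul_tsum_eq_tsum_sum_antidiagonal_of_summable_norm
    (cA_summable z hz) (cA_summable _ hz')
  have hsum := (summable_norm_sum_mul_antidiagonal_of_summable_norm
    (cA_summable z hz) (cA_summable _ hz')).of_norm.hasSum
  rw [← hprod, hFc, ← hF, Complex.mul_conj] at hsum
  have hre := Complex.hasSum_re hsum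
  rw [Complex.ofReal_re] at hre
  have hval : Complex.normSq F = 1 / Real.sqrt (1 + r ^ 2 - 2 * r * Real.cos θ) := by
    have h := congrArg norm (cA_sq z hz)
    rw [← hF, norm_mul, norm_inv] at h
    rw [Complex.normSq_eq_norm_sq, sq, h, one_div]
    congr 1
    rw [Complex.norm_def]
    congr 1
    rw [Complex.normSq_apply]
    have hzr : z.re = r * Real.cos θ := by
      rw [hzdef, Complex.re_ofReal_mul, Complex.exp_ofReal_mul_I_re]
    have hzi : z.im = r * Real.sin θ := by
      rw [hzdef, Complex.im_ofReal_mul, Complex.exp_ofReal_mul_I_im]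
    simp only [Complex.sub_re, Complex.sub_im, Complex.one_re, Complex.one_im, hzr, hzi]
    have := Real.sin_sq_add_cos_sq θ
    linear_combination r ^ 2 * this
  rw [← hval]
  convert hre using 1
  funext n
  rw [lP_eval, Complex.re_sum, mul_sum]
  refine sum_congr rfl fun p hp => ?_
  rw [Finset.HasAntidiagonal.mem_antidiagonal] at hp
  have hterm : (cA p.1 : ℂ) * z ^ p.1 * ((cA p.2 : ℂ) * (conj z) ^ p.2) =
      ((cA p.1 * cA p.2 * r ^ n : ℝ) : ℂ) *
        Complex.exp (((((p.1 : ℝ) - p.2) * θ : ℝ) : ℂ) * Complex.I) := by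
    have he : Complex.exp (((((p.1 : ℝ) - p.2) * θ : ℝ) : ℂ) * Complex.I) =
        Complex.exp (θ * Complex.I) ^ p.1 * Complex.exp (-(θ * Complex.I)) ^ p.2 := by
      rw [← Complex.exp_nat_mul, ← Complex.exp_nat_mul, ← Complex.exp_add]
      congr 1
      push_cast
      ring
    rw [he, hzc, hzdef, ← hp, mul_pow, mul_pow]
    push_cast
    ring
  rw [hterm, Complex.re_ofReal_mul, Complex.exp_ofReal_mul_I_re]
  ring

/-- There is a universal constant `C > 0` such that for all `κ ≥ 2` and
`0 < δ < 1/2`, there is a real polynomial `q` of degree at most `C √κ log(κ/δ)` with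
`|q(x) − x^{−1/2}| ≤ δ/√κ` for all `1 ≤ x ≤ κ`. -/
theorem stmt_17 :
    ∃ C : ℝ, 0 < C ∧
      ∀ κ : ℝ, 2 ≤ κ → ∀ δ : ℝ, 0 < δ → δ < 1 / 2 →
        ∃ q : Polynomial ℝ,
          (q.natDegree : ℝ) ≤ C * Real.sqrt κ * Real.log (κ / δ) ∧
          ∀ x : ℝ, 1 ≤ x → x ≤ κ → |q.eval x - 1 / Real.sqrt x| ≤ δ / Real.sqrt κ := by
  refine ⟨2, by norm_num, fun κ hκ δ hδ hδ' => ?_⟩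
  set s := Real.sqrt κ with hs
  have hss : s * s = κ := Real.mul_self_sqrt (by linarith)
  have hs1 : 1 < s := by rw [hs, Real.lt_sqrt] <;> linarith
  set r := (s - 1) / (s + 1) with hr
  have hr0 : 0 < r := div_pos (by linarith) (by linarith)
  have hr1 : 1 - r = 2 / (s + 1) := by rw [hr]; field_simp; ring
  have hr1' : 0 < 1 - r := by rw [hr1]; exact div_pos (by norm_num) (by linarith)
  have hL : 1 ≤ Real.log (κ / δ) := by
    rw [Real.le_log_iff_exp_le (by positivity)]
    have : 4 ≤ κ / δ := by rw [le_div_iff₀ hδ]; linarith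
    linarith [Real.exp_one_lt_d9]
  have hL' : Real.log (s / δ) ≤ Real.log (κ / δ) := by
    apply Real.log_le_log (by positivity)
    gcongr
    nlinarith
  have hL0 : 0 ≤ Real.log (s / δ) := by
    apply Real.log_nonneg
    rw [le_div_iff₀ hδ]; linarith
  set N := ⌈(s + 1) / 2 * Real.log (s / δ)⌉₊ with hN
  have hN1 : (s + 1) / 2 * Real.log (s / δ) ≤ N := Nat.le_ceil _
  have hN2 : (N : ℝ) < (s + 1) / 2 * Real.log (s / δ) + 1 := Nat.ceil_lt_add_one (by positivity)
  have hrN : r ^ N ≤ δ / s := by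
    have e1 : r ≤ Real.exp (-(1 - r)) := by
      have := Real.add_one_le_exp (-(1 - r)); linarith
    calc r ^ N ≤ Real.exp (-(1 - r)) ^ N := by gcongr
      _ = Real.exp (N * (-(1 - r))) := by rw [Real.exp_nat_mul]
      _ ≤ Real.exp (-Real.log (s / δ)) := by
        rw [Real.exp_le_exp, hr1]
        have : Real.log (s / δ) ≤ N * (2 / (s + 1)) := by
          calc Real.log (s / δ) = (s + 1) / 2 * Real.log (s / δ) * (2 / (s + 1)) := by field_simp
            _ ≤ _ := by gcongr
        linarith
      _ = δ / s := by rw [Real.exp_neg, Real.exp_log (by positivity), inv_div]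
  refine ⟨∑ n ∈ Finset.range N, Polynomial.C ((1 - r) * r ^ n) * (lP n).comp
    (Polynomial.C (-(1 - r) ^ 2 / (2 * r)) * Polynomial.X +
      Polynomial.C ((1 + r ^ 2) / (2 * r))), ?_, fun x hx hxκ => ?_⟩
  · have hd : (∑ n ∈ Finset.range N, Polynomial.C ((1 - r) * r ^ n) * (lP n).comp
        (Polynomial.C (-(1 - r) ^ 2 / (2 * r)) * Polynomial.X +
        Polynomial.C ((1 + r ^ 2) / (2 * r)))).natDegree ≤ N := by
      refine Polynomial.natDegree_sum_le_of_forall_le _ _ fun n hn => ?_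
      refine (Polynomial.natDegree_C_mul_le _ _).trans ?_
      refine Polynomial.natDegree_comp_le.trans ?_
      calc _ ≤ n * 1 := Nat.mul_le_mul (lP_natDegree n) Polynomial.natDegree_linear_le
        _ ≤ N := by rw [mul_one]; exact (Finset.mem_range.1 hn).le
    have hd' := Nat.cast_le (α := ℝ).2 hd
    refine hd'.trans (hN2.le.trans ?_)
    have : (s + 1) / 2 * Real.log (s / δ) ≤ s * Real.log (κ / δ) := by
      gcongr; linarith
    nlinarith
  · set c := -(1 - r) ^ 2 / (2 * r) * x + (1 + r ^ 2) / (2 * r) with hc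
    have hcx : 1 + r ^ 2 - 2 * r * c = (1 - r) ^ 2 * x := by
      rw [hc]; field_simp; ring
    have hc1 : c ≤ 1 := by
      have : (1 - r) ^ 2 * 1 ≤ (1 - r) ^ 2 * x := by gcongr
      nlinarith
    have hc2 : -1 ≤ c := by
      have h1 : (1 - r) ^ 2 * x ≤ (1 - r) ^ 2 * κ := by gcongr
      have h2 : (1 - r) * s = 1 + r := by rw [hr]; field_simp; ring
      have h3 : (1 - r) ^ 2 * κ = (1 + r) ^ 2 := by rw [← hss, ← h2]; ring
      nlinarith
    have hcos : Real.cos (Real.arccos c) = c := Real.cos_arccos hc2 hc1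
    have hsum := lP_hasSum r (Real.arccos c) hr0.le (by linarith)
    rw [hcos, hcx, Real.sqrt_mul (by positivity), Real.sqrt_sq hr1'.le] at hsum
    have hb := norm_sub_le_of_geometric_bound_of_hasSum (r := r) (C := 1) (by linarith)
      (fun n => by
        rw [Real.norm_eq_abs, abs_mul, abs_of_nonneg (by positivity : 0 ≤ r ^ n), mul_comm]
        have := lP_abs n (Real.arccos c)
        rw [hcos] at this
        gcongr) hsum N
    rw [Real.norm_eq_abs] at hb
    rw [Polynomial.eval_finsetSum]
    simp only [Polynomial.eval_mul, Polynomial.eval_C, Polynomial.eval_comp, Polynomial.eval_add,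
      Polynomial.eval_X]
    rw [← hc]
    have hx0 : 0 < Real.sqrt x := Real.sqrt_pos.2 (by linarith)
    have e : ∑ n ∈ Finset.range N, (1 - r) * r ^ n * (lP n).eval c - 1 / Real.sqrt x =
        (1 - r) * (∑ n ∈ Finset.range N, r ^ n * (lP n).eval c - 1 / ((1 - r) * Real.sqrt x)) := by
      rw [mul_sub, Finset.mul_sum]
      congr 1
      · exact Finset.sum_congr rfl fun n _ => by ring
      · field_simp
    rw [e, abs_mul, abs_of_pos hr1']
    calc _ ≤ (1 - r) * (1 * r ^ N / (1 - r)) := by gcongr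
      _ = r ^ N := by field_simp
      _ ≤ _ := hrN
end
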